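/- Let a ≥ b ≥ 1 and g = a + b, and set θ = (e_g · e_{g−2} ⋯ e_{g−2b}) · (e₁ · e₂ ⋯ e_{a−b−1}) in ℂ[x₁,…,x_g] (the second factor being the empty product 1 when a − b − 1 < 1). Then there is a nonzero scalar λ ∈ ℂ with θ − λ·(α₁ α₂ ⋯ α_a)(β₁ β₂ ⋯ β_b) ∈ I_a + I_b; in particular θ ∉ I_a + I_b, i.e. the restriction of θ to the product of compact duals is a nonzero multiple of the top-degree class. -/

import Mathlib

open MvPolynomial

/-- `esq g k` is `e_k(x₁²,…,x_g²)`. -/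
noncomputable def esq (g k : ℕ) : MvPolynomial (Fin g) ℂ :=
  aeval (fun i : Fin g => (X i : MvPolynomial (Fin g) ℂ) ^ 2) (esymm (Fin g) ℂ k)

/-- `α_r`, the `r`-th elementary symmetric polynomial in `x₁,…,x_a`. -/
noncomputable def alph (a b r : ℕ) : MvPolynomial (Fin (a + b)) ℂ :=
  rename (Fin.castAdd b) (esymm (Fin a) ℂ r)

/-- `β_s`, the `s`-th elementary symmetric polynomial in `x_{a+1},…,x_{a+b}`. -/
noncomputable def bet (a b s : ℕ) : MvPolynomial (Fin (a + b)) ℂ :=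
  rename (Fin.natAdd a) (esymm (Fin b) ℂ s)

/-- The ideal `I_a` generated by `e_r(x₁²,…,x_a²)` for `1 ≤ r ≤ a`. -/
noncomputable def Ia (a b : ℕ) : Ideal (MvPolynomial (Fin (a + b)) ℂ) :=
  Ideal.span {p | ∃ r : ℕ, 1 ≤ r ∧ r ≤ a ∧ p = rename (Fin.castAdd b) (esq a r)}

/-- The ideal `I_b` generated by `e_s(x_{a+1}²,…,x_{a+b}²)` for `1 ≤ s ≤ b`. -/
noncomputable def Ib (a b : ℕ) : Ideal (MvPolynomial (Fin (a + b)) ℂ) :=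
  Ideal.span {p | ∃ s : ℕ, 1 ≤ s ∧ s ≤ b ∧ p = rename (Fin.natAdd a) (esq b s)}

/-- `θ = (e_g e_{g-2} ⋯ e_{g-2b}) · (e₁ e₂ ⋯ e_{a-b-1})` in `ℂ[x₁,…,x_{a+b}]`
(the second factor being the empty product `1` when `a - b - 1 < 1`). -/
noncomputable def theta (a b : ℕ) : MvPolynomial (Fin (a + b)) ℂ :=
  (∏ j ∈ Finset.range (b + 1), esymm (Fin (a + b)) ℂ (a + b - 2 * j)) *
    ∏ r ∈ Finset.Icc 1 (a - b - 1), esymm (Fin (a + b)) ℂ r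

section Generating

/-- The coefficients of `∏ i, (1 + y i * t)` are the elementary symmetric functions of `y`. -/
theorem coeff_prod_one_add_C_mul_X {R σ : Type*} [CommRing R] [Fintype σ] (y : σ → R) (k : ℕ) :
    (∏ i, (1 + Polynomial.C (y i) * Polynomial.X)).coeff k =
      ∑ t ∈ Finset.powersetCard k Finset.univ, ∏ i ∈ t, y i := by
  classical
  rw [Finset.prod_one_add, Polynomial.finsetSum_coeff, Finset.powersetCard_eq_filter,
    Finset.sum_filter]
  refine Finset.sum_congr rfl fun t _ => ?_
  rw [Finset.prod_mul_distrib, Finset.prod_const, ← map_prod, Polynomial.coeff_C_mul_X_pow]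
  simp only [eq_comm]

theorem aeval_esymm_eq_coeff {S R σ : Type*} [CommRing S] [CommRing R] [Algebra S R] [Fintype σ]
    (y : σ → R) (k : ℕ) :
    aeval y (esymm σ S k) = (∏ i, (1 + Polynomial.C (y i) * Polynomial.X)).coeff k := by
  rw [aeval_esymm_eq_multiset_esymm σ S, coeff_prod_one_add_C_mul_X, Finset.esymm_map_val]

theorem aeval_esymm_fin_add {S R : Type*} [CommRing S] [CommRing R] [Algebra S R] {a b : ℕ}
    (y : Fin (a + b) → R) (k : ℕ) :
    aeval y (esymm (Fin (a + b)) S k) = ∑ p ∈ Finset.HasAntidiagonal.antidiagonal k,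
      aeval (fun i => y (Fin.castAdd b i)) (esymm (Fin a) S p.1) *
        aeval (fun i => y (Fin.natAdd a i)) (esymm (Fin b) S p.2) := by
  simp only [aeval_esymm_eq_coeff, Fin.prod_univ_add, Polynomial.coeff_mul]

/-- The identity `∑_{i+j=2r} (-1)^j e_i e_j = (-1)^r e_r(y²)`. -/
theorem sum_antidiagonal_aeval_esymm {S R σ : Type*} [CommRing S] [CommRing R] [Algebra S R]
    [Fintype σ] (y : σ → R) (r : ℕ) :
    ∑ p ∈ Finset.HasAntidiagonal.antidiagonal (2 * r),
      aeval y (esymm σ S p.1) * ((-1) ^ p.2 * aeval y (esymm σ S p.2)) =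
    (-1) ^ r * aeval (fun i => y i ^ 2) (esymm σ S r) := by
  have hneg (z : σ → R) (k : ℕ) : (-1) ^ k * aeval z (esymm σ S k) =
      aeval (fun i => -z i) (esymm σ S k) := by
    simp only [aeval_esymm_eq_coeff, coeff_prod_one_add_C_mul_X, Finset.mul_sum]
    refine Finset.sum_congr rfl fun t ht => ?_
    rw [Finset.prod_neg, (Finset.mem_powersetCard.1 ht).2]
  simp only [hneg]
  simp only [aeval_esymm_eq_coeff]
  rw [← Polynomial.coeff_mul, ← Finset.prod_mul_distrib, mul_comm 2 r,
    ← Polynomial.coeff_expand_mul two_pos (∏ i, (1 + Polynomial.C (-(y i ^ 2)) * Polynomial.X)) r,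
    map_prod]
  congr 2
  funext i
  simp only [map_add, map_mul, map_one, map_neg, map_pow, Polynomial.expand_C, Polynomial.expand_X]
  ring

end Generating

section Congruence

variable {Q : Type*} [CommRing Q] (α β : ℕ → Q)

theorem prod_range_mul_eq_zero (a : ℕ) (h0 : ∀ i, a < i → α i = 0)
    (hsq : ∀ j, 1 ≤ j → j ≤ a → ∀ c, (∀ i, j < i → c * α i = 0) → c * α j ^ 2 = 0)
    (k : ℕ) (hk : k ≤ a) (j : ℕ) (hj : a - k < j) :
    (∏ i ∈ Finset.range k, α (a - i)) * α j = 0 := by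
  induction k generalizing j with
  | zero => rw [h0 j (by omega), mul_zero]
  | succ k ih =>
    rw [Finset.prod_range_succ]
    rcases eq_or_ne j (a - k) with rfl | hne
    · rw [mul_assoc, ← sq]
      exact hsq _ (by omega) (by omega) _ fun i hi => ih (by omega) i hi
    · rw [mul_right_comm, ih (by omega) j (by omega), zero_mul]

theorem prod_range_sub_eq_prod_Icc (a : ℕ) :
    ∏ i ∈ Finset.range a, α (a - i) = ∏ i ∈ Finset.Icc 1 a, α i := by
  rw [← Finset.prod_range_reflect, Finset.range_eq_Ico]
  have h := Finset.prod_Ico_add' (fun i => α i) 0 a 1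
  rw [show Finset.Icc 1 a = Finset.Ico (0 + 1) (a + 1) from rfl, ← h]
  refine Finset.prod_congr rfl fun i hi => ?_
  rw [Finset.mem_Ico] at hi
  congr 1
  omega

theorem prod_convolution_eq (a b : ℕ) (hab : b ≤ a) (e : ℕ → Q) (hα : α 0 = 1) (hβ : β 0 = 1)
    (hα0 : ∀ i, a < i → α i = 0) (hβ0 : ∀ i, b < i → β i = 0)
    (hαsq : ∀ j, 1 ≤ j → j ≤ a → ∀ c, (∀ i, j < i → c * α i = 0) → c * α j ^ 2 = 0)
    (hβsq : ∀ j, 1 ≤ j → j ≤ b → ∀ c, (∀ i, j < i → c * β i = 0) → c * β j ^ 2 = 0)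
    (he : ∀ k, e k = ∑ p ∈ Finset.HasAntidiagonal.antidiagonal k, α p.1 * β p.2) :
    (∏ j ∈ Finset.range (b + 1), e (a + b - 2 * j)) * ∏ r ∈ Finset.Icc 1 (a - b - 1), e r =
      (∏ r ∈ Finset.Icc 1 a, α r) * ∏ s ∈ Finset.Icc 1 b, β s := by
  have hA := prod_range_mul_eq_zero α a hα0 hαsq
  have hB := prod_range_mul_eq_zero β b hβ0 hβsq
  set A : ℕ → Q := fun k => ∏ i ∈ Finset.range k, α (a - i) with hAdef
  set B : ℕ → Q := fun k => ∏ i ∈ Finset.range k, β (b - i) with hBdef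
  have step (k : ℕ) (hk : k ≤ b) :
      A k * B k * e (a + b - 2 * k) = A k * B k * (α (a - k) * β (b - k)) := by
    rw [he, Finset.mul_sum]
    refine Finset.sum_eq_single_of_mem (a - k, b - k)
      (Finset.HasAntidiagonal.mem_antidiagonal.2 (by dsimp only; omega)) ?_
    rintro ⟨i, j⟩ hij hne
    rw [Finset.HasAntidiagonal.mem_antidiagonal] at hij
    dsimp only at hij ⊢
    rcases lt_trichotomy i (a - k) with h | h | h
    · linear_combination A k * α i * hB k hk j (by omega)
    · exact absurd (Prod.ext h (by dsimp only; omega)) hne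
    · linear_combination B k * β j * hA k (hk.trans hab) i h
  have top (k : ℕ) (hk : k ≤ b) :
      ∏ j ∈ Finset.range k, e (a + b - 2 * j) = A k * B k := by
    induction k with
    | zero => simp [hAdef, hBdef]
    | succ k ih =>
      rw [Finset.prod_range_succ, ih (by omega), step k (by omega)]
      simp only [hAdef, hBdef, Finset.prod_range_succ]
      ring
  have low (r : ℕ) : B b * e r = B b * α r := by
    rw [he, Finset.mul_sum]
    refine (Finset.sum_eq_single_of_mem (r, 0) (by simp) ?_).trans (by simp [hβ])
    rintro ⟨i, j⟩ hij hne
    rw [Finset.HasAntidiagonal.mem_antidiagonal] at hij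
    dsimp only at hij ⊢
    have hj : b - b < j := by
      rcases Nat.eq_zero_or_pos j with rfl | h
      · exact (hne (Prod.ext hij rfl)).elim
      · omega
    linear_combination α i * hB b le_rfl j hj
  have low' (s : Finset ℕ) : B b * ∏ r ∈ s, e r = B b * ∏ r ∈ s, α r := by
    classical
    induction s using Finset.induction_on with
    | empty => rfl
    | insert r s hr ih =>
      rw [Finset.prod_insert hr, Finset.prod_insert hr]
      linear_combination (∏ r ∈ s, e r) * low r + α r * ih
  have hsplit : A b * (α (a - b) * ∏ r ∈ Finset.Icc 1 (a - b - 1), α r) =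
      ∏ r ∈ Finset.Icc 1 a, α r := by
    have hc : α (a - b) * ∏ r ∈ Finset.Icc 1 (a - b - 1), α r =
        ∏ r ∈ Finset.range (a - b), α (a - b - r) := by
      rw [prod_range_sub_eq_prod_Icc]
      rcases Nat.eq_zero_or_pos (a - b) with h | h
      · simp [h, hα]
      · obtain ⟨c, hc⟩ : ∃ c, a - b = c + 1 := ⟨a - b - 1, by omega⟩
        rw [hc, Nat.add_sub_cancel, Finset.prod_Icc_succ_top (by omega), mul_comm]
    rw [hc, ← prod_range_sub_eq_prod_Icc α a]
    conv_rhs => rw [← Nat.add_sub_cancel' hab, Finset.prod_range_add]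
    simp only [hAdef, Nat.add_sub_cancel' hab, Nat.sub_sub]
  rw [Finset.prod_range_succ, top b le_rfl, step b le_rfl, ← hsplit, ← prod_range_sub_eq_prod_Icc β,
    Nat.sub_self, hβ]
  change _ = _ * B b
  linear_combination A b * α (a - b) * low' (Finset.Icc 1 (a - b - 1))

end Congruence

section Nonvanishing

variable {S : Type*} [CommRing S] {n : ℕ}

/-- The alternating sum of the permutations of a polynomial. -/
noncomputable def antisymmetrize (h : MvPolynomial (Fin n) S) : MvPolynomial (Fin n) S :=
  ∑ σ : Equiv.Perm (Fin n), ((Equiv.Perm.sign σ : ℤˣ) : ℤ) • rename σ h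

theorem antisymmetrize_add (h k : MvPolynomial (Fin n) S) :
    antisymmetrize (h + k) = antisymmetrize h + antisymmetrize k := by
  simp only [antisymmetrize, map_add, smul_add, Finset.sum_add_distrib]

theorem antisymmetrize_mul (h q : MvPolynomial (Fin n) S) (hq : q.IsSymmetric) :
    antisymmetrize (h * q) = antisymmetrize h * q := by
  simp only [antisymmetrize, map_mul, hq _, Finset.sum_mul, smul_mul_assoc]

theorem rename_antisymmetrize (h : MvPolynomial (Fin n) S) {τ : Equiv.Perm (Fin n)}
    (hτ : Equiv.Perm.sign τ = -1) : rename τ (antisymmetrize h) = -antisymmetrize h := by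
  rw [antisymmetrize, map_sum, ← Finset.sum_neg_distrib]
  refine Fintype.sum_equiv (Equiv.mulLeft τ) _ _ fun σ => ?_
  simp [hτ, rename_rename, Function.comp_def, Equiv.Perm.coe_mul]

theorem coeff_antisymmetrize_eq_zero [Algebra ℚ S] (h : MvPolynomial (Fin n) S)
    (m : Fin n →₀ ℕ) {i j : Fin n} (hij : i ≠ j) (hm : m i = m j) :
    coeff m (antisymmetrize h) = 0 := by
  have hmap : m.mapDomain (Equiv.swap i j) = m := by
    ext k
    rw [Finsupp.mapDomain_equiv_apply, Equiv.symm_swap, Equiv.swap_apply_def]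
    split_ifs <;> simp_all
  have h1 := coeff_rename_mapDomain _ (Equiv.swap i j).injective (antisymmetrize h) m
  rw [hmap, rename_antisymmetrize h (Equiv.Perm.sign_swap hij), coeff_neg] at h1
  have h2 : (2 : ℚ) • coeff m (antisymmetrize h) = 0 := by
    rw [two_smul]; linear_combination -h1
  simpa using congrArg ((2 : ℚ)⁻¹ • ·) h2

/-- The exponent vector `(1, 3, 5, …, 2n - 1)`. -/
noncomputable def oddExponent (n : ℕ) : Fin n →₀ ℕ :=
  Finsupp.equivFunOnFinite.symm fun i => 2 * i + 1

/-- The exponent vector `(0, 1, 2, …, n - 1)`. -/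
noncomputable def staircaseExponent (n : ℕ) : Fin n →₀ ℕ :=
  Finsupp.equivFunOnFinite.symm fun i => i

/-- The indicator function of a set of variables. -/
noncomputable def indicatorExponent (T : Finset (Fin n)) : Fin n →₀ ℕ :=
  ∑ i ∈ T, Finsupp.single i 1

theorem indicatorExponent_apply (T : Finset (Fin n)) (i : Fin n) :
    indicatorExponent T i = if i ∈ T then 1 else 0 := by
  classical
  simp [indicatorExponent, Finsupp.finsetSum_apply, Finsupp.single_apply]

theorem esymm_eq_sum_monomial_indicatorExponent (r : ℕ) :
    esymm (Fin n) S r =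
      ∑ T ∈ Finset.powersetCard r Finset.univ, monomial (indicatorExponent T) 1 :=
  esymm_eq_sum_monomial _ _ _

/-- The polynomial `e_r(x₁²,…,x_n²)`. -/
noncomputable def squareEsymm (S : Type*) [CommRing S] (n r : ℕ) : MvPolynomial (Fin n) S :=
  aeval (fun i : Fin n => (X i : MvPolynomial (Fin n) S) ^ 2) (esymm (Fin n) S r)

theorem squareEsymm_isSymmetric (r : ℕ) : (squareEsymm S n r).IsSymmetric := by
  intro σ
  conv_rhs => rw [squareEsymm, ← esymm_isSymmetric (Fin n) S r σ, aeval_rename]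
  rw [squareEsymm, ← AlgHom.comp_apply, comp_aeval]
  simp [Function.comp_def]

theorem squareEsymm_eq_sum_monomial (r : ℕ) :
    squareEsymm S n r =
      ∑ T ∈ Finset.powersetCard r Finset.univ, monomial (2 • indicatorExponent T) 1 := by
  rw [squareEsymm, esymm_eq_sum_monomial_indicatorExponent, map_sum]
  refine Finset.sum_congr rfl fun T _ => ?_
  have h := expand_monomial 2 (indicatorExponent T) (1 : S)
  rw [← h]
  rfl

theorem coeff_antisymmetrize_mul_squareEsymm [Algebra ℚ S] (h : MvPolynomial (Fin n) S) {r : ℕ}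
    (hr : 1 ≤ r) : coeff (oddExponent n) (antisymmetrize (h * squareEsymm S n r)) = 0 := by
  rw [antisymmetrize_mul _ _ (squareEsymm_isSymmetric r), squareEsymm_eq_sum_monomial,
    Finset.mul_sum, coeff_sum]
  refine Finset.sum_eq_zero fun T hT => ?_
  rw [Finset.mem_powersetCard] at hT
  rw [coeff_mul_monomial', mul_one]
  split_ifs with hle
  · have hne : T.Nonempty := Finset.card_pos.1 (by omega)
    set i := T.min' hne
    have hi : i ∈ T := T.min'_mem hne
    have hlei := hle i
    simp only [Finsupp.smul_apply, indicatorExponent_apply, if_pos hi, oddExponent,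
      Finsupp.equivFunOnFinite_symm_apply_apply, smul_eq_mul] at hlei
    have hlt : (i : ℕ) - 1 < i := by omega
    set j : Fin n := ⟨(i : ℕ) - 1, by omega⟩
    have hj : j ∉ T := fun hj => absurd (T.min'_le j hj) (not_le.2 hlt)
    refine coeff_antisymmetrize_eq_zero h _ (i := i) (j := j) (ne_of_gt hlt) ?_
    simp only [Finsupp.tsub_apply, Finsupp.smul_apply, indicatorExponent_apply, if_pos hi,
      if_neg hj, oddExponent, Finsupp.equivFunOnFinite_symm_apply_apply, smul_eq_mul, j]
    omega
  · rfl

/-- The set of the `r` largest elements of `Fin n`. -/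
def topSet (n r : ℕ) : Finset (Fin n) := {i | n ≤ i + r}

theorem mem_topSet {r : ℕ} {i : Fin n} : i ∈ topSet n r ↔ n ≤ i + r := by simp [topSet]

theorem card_topSet {r : ℕ} (hr : r ≤ n) : (topSet n r).card = r := by
  have h : (topSet n r).card = (Finset.univ.filter fun i : Fin n => (i : ℕ) < r).card := by
    refine Finset.card_equiv Fin.revPerm fun i => ?_
    simp only [mem_topSet, Finset.mem_filter_univ, Fin.revPerm_apply, Fin.val_rev]
    omega
  rw [h, Fin.card_filter_val_lt, min_eq_right hr]

theorem sum_le_sum_topSet {T : Finset (Fin n)} {r : ℕ} (hT : T.card = r) (hr : r ≤ n) :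
    ∑ i ∈ T, ((i : ℕ) : ℤ) ≤ ∑ i ∈ topSet n r, ((i : ℕ) : ℤ) := by
  classical
  have h : ∑ i ∈ T, (((i : ℕ) : ℤ) - (n - r)) ≤ ∑ i ∈ topSet n r, (((i : ℕ) : ℤ) - (n - r)) := by
    rw [← Finset.sum_ite_mem_eq T, ← Finset.sum_ite_mem_eq (topSet n r)]
    refine Finset.sum_le_sum fun i _ => ?_
    simp only [mem_topSet]
    split_ifs <;> omega
  simp only [Finset.sum_sub_distrib, Finset.sum_const, hT, card_topSet hr] at h
  linarith

theorem sum_indicatorExponent_topSet (i : Fin n) :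
    ∑ r : Fin n, (if i ∈ topSet n (r + 1) then 1 else 0) = (i : ℕ) + 1 := by
  rw [← Finset.card_filter]
  have h : (Finset.univ.filter fun r : Fin n => i ∈ topSet n (r + 1)) = topSet n (i + 1) := by
    ext r
    simp only [mem_topSet, Finset.mem_filter_univ]
    omega
  rw [h, card_topSet i.isLt]

theorem eq_one_of_mapDomain_staircaseExponent_add {f : Fin n → Finset (Fin n)}
    (hf : ∀ r, (f r).card = r + 1) {σ : Equiv.Perm (Fin n)}
    (h : (staircaseExponent n).mapDomain σ + ∑ r, indicatorExponent (f r) = oddExponent n) :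
    σ = 1 := by
  set m : Fin n → ℤ := fun i => ∑ r, if i ∈ f r then 1 else 0 with hm
  have hi (i : Fin n) : ((σ.symm i : ℕ) : ℤ) + m i = 2 * (i : ℕ) + 1 := by
    have := DFunLike.congr_fun h i
    simp only [Finsupp.add_apply, Finsupp.mapDomain_equiv_apply, Finsupp.finsetSum_apply,
      indicatorExponent_apply, staircaseExponent, oddExponent,
      Finsupp.equivFunOnFinite_symm_apply_apply] at this
    simp only [hm]
    exact_mod_cast this
  have hle : ∑ i : Fin n, ((i : ℕ) : ℤ) * m i ≤ ∑ i : Fin n, ((i : ℕ) : ℤ) * ((i : ℕ) + 1) := by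
    calc ∑ i : Fin n, ((i : ℕ) : ℤ) * m i = ∑ r, ∑ i ∈ f r, ((i : ℕ) : ℤ) := by
          simp only [hm, Finset.mul_sum, mul_ite, mul_one, mul_zero]
          rw [Finset.sum_comm]
          simp only [Finset.sum_ite_mem_eq]
      _ ≤ ∑ r : Fin n, ∑ i ∈ topSet n (r + 1), ((i : ℕ) : ℤ) :=
          Finset.sum_le_sum fun r _ => sum_le_sum_topSet (hf r) r.isLt
      _ = ∑ i : Fin n, ((i : ℕ) : ℤ) * ((i : ℕ) + 1) := by
          simp only [← Finset.sum_ite_mem_eq (topSet n _)]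
          rw [Finset.sum_comm]
          refine Finset.sum_congr rfl fun i _ => ?_
          have := congrArg (Nat.cast : ℕ → ℤ) (sum_indicatorExponent_topSet i)
          push_cast at this
          rw [← this, Finset.mul_sum]
          simp only [mul_ite, mul_one, mul_zero]
  have hsq : ∑ i : Fin n, ((σ.symm i : ℕ) : ℤ) ^ 2 = ∑ i : Fin n, ((i : ℕ) : ℤ) ^ 2 :=
    Equiv.sum_comp σ.symm fun i : Fin n => ((i : ℕ) : ℤ) ^ 2
  have hzero : ∑ i : Fin n, (((i : ℕ) : ℤ) - (σ.symm i : ℕ)) ^ 2 ≤ 0 := by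
    have hterm (i : Fin n) : (((i : ℕ) : ℤ) - (σ.symm i : ℕ)) ^ 2 =
        ((σ.symm i : ℕ) : ℤ) ^ 2 - ((i : ℕ) : ℤ) ^ 2 +
          2 * (((i : ℕ) : ℤ) * m i - ((i : ℕ) : ℤ) * ((i : ℕ) + 1)) := by
      linear_combination 2 * ((i : ℕ) : ℤ) * (-hi i)
    simp only [hterm, Finset.sum_add_distrib, Finset.sum_sub_distrib, ← Finset.mul_sum, hsq]
    linarith
  have hall := (Finset.sum_eq_zero_iff_of_nonneg fun i _ => sq_nonneg _).1
    (le_antisymm hzero (Finset.sum_nonneg fun i _ => sq_nonneg _))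
  refine Equiv.symm_bijective.injective (Equiv.ext fun i => Fin.ext ?_)
  have := pow_eq_zero_iff two_ne_zero |>.1 (hall i (Finset.mem_univ i))
  change (σ.symm i : ℕ) = i
  omega

theorem prod_Icc_esymm_eq_sum_monomial :
    ∏ r ∈ Finset.Icc 1 n, esymm (Fin n) S r =
      ∑ f ∈ Fintype.piFinset fun r : Fin n =>
        Finset.powersetCard ((r : ℕ) + 1) (Finset.univ : Finset (Fin n)),
        monomial (∑ r, indicatorExponent (f r)) 1 := by
  classical
  have h : ∏ r ∈ Finset.Icc 1 n, esymm (Fin n) S r =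
      ∏ r : Fin n, esymm (Fin n) S ((r : ℕ) + 1) := by
    rw [Fin.prod_univ_eq_prod_range (fun r => esymm (Fin n) S (r + 1)), Finset.range_eq_Ico,
      Finset.prod_Ico_add' (fun r => esymm (Fin n) S r) 0 n 1]
    rfl
  rw [h]
  simp only [esymm_eq_sum_monomial_indicatorExponent, Finset.prod_univ_sum, monomial_sum_one]

theorem exists_coeff_antisymmetrize_staircase_mul :
    ∃ N : ℕ, N ≠ 0 ∧ coeff (oddExponent n)
      (antisymmetrize (monomial (staircaseExponent n) (1 : S)) *
        ∏ r ∈ Finset.Icc 1 n, esymm (Fin n) S r) = N := by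
  classical
  set F := Fintype.piFinset fun r : Fin n =>
    Finset.powersetCard ((r : ℕ) + 1) (Finset.univ : Finset (Fin n)) with hF
  refine ⟨(F.filter fun f =>
    staircaseExponent n + ∑ r, indicatorExponent (f r) = oddExponent n).card, ?_, ?_⟩
  · refine Finset.card_ne_zero_of_mem (a := fun r : Fin n => topSet n (r + 1)) ?_
    simp only [hF, Finset.mem_filter, Fintype.mem_piFinset, Finset.mem_powersetCard_univ]
    refine ⟨fun r => card_topSet r.isLt, ?_⟩
    ext i
    simp only [Finsupp.add_apply, Finsupp.finsetSum_apply, indicatorExponent_apply,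
      sum_indicatorExponent_topSet, staircaseExponent, oddExponent,
      Finsupp.equivFunOnFinite_symm_apply_apply]
    ring
  · rw [prod_Icc_esymm_eq_sum_monomial, antisymmetrize, Finset.sum_mul, coeff_sum,
      Finset.sum_eq_single_of_mem 1 (Finset.mem_univ _)]
    · simp only [Equiv.Perm.sign_one, Units.val_one, one_smul, Equiv.Perm.coe_one, rename_id_apply,
        Finset.mul_sum, monomial_mul, mul_one, coeff_sum, coeff_monomial, Finset.sum_boole, hF]
    · intro σ _ hσ
      rw [rename_monomial, smul_mul_assoc, coeff_smul, Finset.mul_sum, coeff_sum,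
        Finset.sum_eq_zero, smul_zero]
      intro f hf
      rw [monomial_mul, coeff_monomial, if_neg]
      refine fun h => hσ (eq_one_of_mapDomain_staircaseExponent_add (fun r => ?_) h)
      exact Finset.mem_powersetCard_univ.1 (Fintype.mem_piFinset.1 hf r)

/-- The product `e_1 e_2 ⋯ e_n` has no nonzero `S`-multiple in the ideal of the `e_r(x²)`. -/
theorem eq_zero_of_C_mul_prod_esymm_mem [Algebra ℚ S] (s : S)
    (h : C s * ∏ r ∈ Finset.Icc 1 n, esymm (Fin n) S r ∈
      Ideal.span {p | ∃ r : ℕ, 1 ≤ r ∧ r ≤ n ∧ p = squareEsymm S n r}) : s = 0 := by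
  have key : ∀ p ∈ Ideal.span {p | ∃ r : ℕ, 1 ≤ r ∧ r ≤ n ∧ p = squareEsymm S n r},
      ∀ q, coeff (oddExponent n) (antisymmetrize (q * p)) = 0 := by
    intro p hp
    induction hp using Submodule.span_induction with
    | mem x hx =>
      obtain ⟨r, hr, -, rfl⟩ := hx
      exact fun q => coeff_antisymmetrize_mul_squareEsymm q hr
    | zero => intro q; simp [antisymmetrize]
    | add x y _ _ hx hy => intro q; rw [mul_add, antisymmetrize_add, coeff_add, hx, hy, add_zero]
    | smul c x _ hx => intro q; rw [smul_eq_mul, ← mul_assoc]; exact hx _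
  have hsymm : (∏ r ∈ Finset.Icc 1 n, esymm (Fin n) S r).IsSymmetric := fun σ => by
    rw [map_prod]
    exact Finset.prod_congr rfl fun r _ => esymm_isSymmetric _ _ r σ
  obtain ⟨N, hN, hcoeff⟩ := exists_coeff_antisymmetrize_staircase_mul (S := S) (n := n)
  have h0 := key _ h (monomial (staircaseExponent n) 1)
  rw [antisymmetrize_mul _ _ ((IsSymmetric.C s).mul hsymm), mul_left_comm, coeff_C_mul,
    hcoeff] at h0
  have h1 : (N : ℚ) • s = 0 := by
    rw [Nat.cast_smul_eq_nsmul, nsmul_eq_mul, mul_comm, h0]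
  simpa [hN] using congrArg ((N : ℚ)⁻¹ • ·) h1

end Nonvanishing

section Quotient

theorem aeval_esymm_eq_zero_of_lt {R : Type*} [CommRing R] [Algebra ℂ R] {n : ℕ} (y : Fin n → R)
    {k : ℕ} (hk : n < k) : aeval y (esymm (Fin n) ℂ k) = 0 := by
  rw [esymm, Finset.powersetCard_eq_empty.2 (by simpa using hk), Finset.sum_empty, map_zero]

theorem mul_aeval_esymm_sq_eq_zero {R : Type*} [CommRing R] [Algebra ℂ R] {n : ℕ} (y : Fin n → R)
    {j : ℕ} (hj : aeval (fun i => y i ^ 2) (esymm (Fin n) ℂ j) = 0) (c : R)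
    (hc : ∀ i, j < i → c * aeval y (esymm (Fin n) ℂ i) = 0) :
    c * aeval y (esymm (Fin n) ℂ j) ^ 2 = 0 := by
  have h := congrArg (c * ·) (sum_antidiagonal_aeval_esymm (S := ℂ) y j)
  simp only [hj, mul_zero, Finset.mul_sum] at h
  rw [Finset.sum_eq_single_of_mem (j, j)
    (Finset.HasAntidiagonal.mem_antidiagonal.2 (by dsimp only; omega))] at h
  · have hsign : ((-1 : R) ^ j) * (-1) ^ j = 1 := by rw [← mul_pow]; simp
    linear_combination (-1) ^ j * h - c * aeval y (esymm (Fin n) ℂ j) ^ 2 * hsign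
  · rintro ⟨i, k⟩ hik hne
    rw [Finset.HasAntidiagonal.mem_antidiagonal] at hik
    dsimp only at hik ⊢
    rcases lt_trichotomy i j with h' | h' | h'
    · linear_combination (-1) ^ k * aeval y (esymm (Fin n) ℂ i) * hc k (by omega)
    · exact absurd (Prod.ext h' (by dsimp only; omega)) hne
    · linear_combination (-1) ^ k * aeval y (esymm (Fin n) ℂ k) * hc i h'

theorem algHom_rename_esq {R : Type*} [CommRing R] [Algebra ℂ R] {σ : Type*} {n : ℕ}
    (φ : MvPolynomial σ ℂ →ₐ[ℂ] R) (f : Fin n → σ) (r : ℕ) :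
    φ (rename f (esq n r)) = aeval (fun i => φ (X (f i)) ^ 2) (esymm (Fin n) ℂ r) := by
  rw [esq, ← AlgHom.comp_apply, ← AlgHom.comp_apply, comp_aeval]
  simp

theorem algHom_rename {R : Type*} [CommRing R] [Algebra ℂ R] {σ τ : Type*}
    (φ : MvPolynomial σ ℂ →ₐ[ℂ] R) (f : τ → σ) (p : MvPolynomial τ ℂ) :
    φ (rename f p) = aeval (fun i => φ (X (f i))) p := by
  rw [← AlgHom.comp_apply, aeval_unique (φ.comp (rename f))]
  simp [Function.comp_def]

theorem theta_sub_mem (a b : ℕ) (hab : b ≤ a) :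
    theta a b - (∏ r ∈ Finset.Icc 1 a, alph a b r) * (∏ s ∈ Finset.Icc 1 b, bet a b s) ∈
      Ia a b + Ib a b := by
  set π := Ideal.Quotient.mkₐ ℂ (Ia a b + Ib a b)
  rw [← Ideal.Quotient.mk_eq_mk_iff_sub_mem]
  change π _ = π _
  have hker (p) (hp : p ∈ Ia a b + Ib a b) : π p = 0 := Ideal.Quotient.eq_zero_iff_mem.2 hp
  simp only [theta, alph, bet, map_mul, map_prod, algHom_rename π]
  have hesymm (k : ℕ) : π (esymm (Fin (a + b)) ℂ k) =
      aeval (fun i => π (X i)) (esymm (Fin (a + b)) ℂ k) := by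
    simpa using algHom_rename π id (esymm (Fin (a + b)) ℂ k)
  refine prod_convolution_eq (fun k => aeval (fun i => π (X (Fin.castAdd b i))) (esymm (Fin a) ℂ k))
    (fun k => aeval (fun i => π (X (Fin.natAdd a i))) (esymm (Fin b) ℂ k)) a b hab
    (fun k => π (esymm (Fin (a + b)) ℂ k)) (by simp) (by simp)
    (fun _ => aeval_esymm_eq_zero_of_lt _) (fun _ => aeval_esymm_eq_zero_of_lt _)
    (fun j h1 hj => mul_aeval_esymm_sq_eq_zero _ ?_)
    (fun j h1 hj => mul_aeval_esymm_sq_eq_zero _ ?_)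
    (fun k => (hesymm k).trans (aeval_esymm_fin_add _ k))
  · rw [← algHom_rename_esq π]
    exact hker _ (Ideal.mem_sup_left (Ideal.subset_span ⟨j, h1, hj, rfl⟩))
  · rw [← algHom_rename_esq π]
    exact hker _ (Ideal.mem_sup_right (Ideal.subset_span ⟨j, h1, hj, rfl⟩))

theorem exists_algHom_esymm (a b : ℕ) {S : Type*} [CommRing S] [Algebra ℂ S]
    (π : MvPolynomial (Fin b) ℂ →ₐ[ℂ] S) :
    ∃ φ : MvPolynomial (Fin (a + b)) ℂ →ₐ[ℂ] MvPolynomial (Fin a) S,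
      (∀ r, φ (alph a b r) = esymm (Fin a) S r) ∧
      (∀ r, φ (rename (Fin.castAdd b) (esq a r)) = squareEsymm S a r) ∧
      ∀ p, φ (rename (Fin.natAdd a) p) = C (π p) := by
  let φ : MvPolynomial (Fin (a + b)) ℂ →ₐ[ℂ] MvPolynomial (Fin a) S :=
    aeval (Fin.addCases X fun j => C (π (X j)))
  have hleft (i : Fin a) : φ (X (Fin.castAdd b i)) = X i := by simp [φ]
  have hright (i : Fin b) : φ (X (Fin.natAdd a i)) = C (π (X i)) := by simp [φ]
  refine ⟨φ, fun r => ?_, fun r => ?_, fun p => ?_⟩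
  · rw [alph, algHom_rename]
    simp only [hleft]
    rw [aeval_esymm_eq_coeff, ← aeval_esymm_eq_coeff (S := S), aeval_X_left_apply]
  · rw [algHom_rename_esq, squareEsymm]
    simp only [hleft]
    rw [aeval_esymm_eq_coeff, ← aeval_esymm_eq_coeff (S := S)]
  · rw [algHom_rename]
    simp only [hright]
    exact (DFunLike.congr_fun
      (aeval_unique ((IsScalarTower.toAlgHom ℂ S (MvPolynomial (Fin a) S)).comp π)) p).symm

theorem prod_alph_mul_prod_bet_notMem (a b : ℕ) :
    (∏ r ∈ Finset.Icc 1 a, alph a b r) * (∏ s ∈ Finset.Icc 1 b, bet a b s) ∉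
      Ia a b + Ib a b := by
  intro hmem
  set J : Ideal (MvPolynomial (Fin b) ℂ) :=
    Ideal.span {p | ∃ r : ℕ, 1 ≤ r ∧ r ≤ b ∧ p = squareEsymm ℂ b r}
  obtain ⟨φ, halph, hesq, hC⟩ := exists_algHom_esymm a b (Ideal.Quotient.mkₐ ℂ J)
  have hle : Ia a b + Ib a b ≤ Ideal.comap φ (Ideal.span
      {p | ∃ r : ℕ, 1 ≤ r ∧ r ≤ a ∧ p = squareEsymm (MvPolynomial (Fin b) ℂ ⧸ J) a r}) := by
    refine sup_le (Ideal.span_le.2 ?_) (Ideal.span_le.2 ?_)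
    · rintro _ ⟨r, h1, hr, rfl⟩
      exact Ideal.mem_comap.2 (hesq r ▸ Ideal.subset_span ⟨r, h1, hr, rfl⟩)
    · rintro _ ⟨r, h1, hr, rfl⟩
      have hr0 : Ideal.Quotient.mkₐ ℂ J (esq b r) = 0 :=
        Ideal.Quotient.eq_zero_iff_mem.2 (Ideal.subset_span ⟨r, h1, hr, rfl⟩)
      refine Ideal.mem_comap.2 ?_
      rw [hC, hr0, C_0]
      exact zero_mem _
  have hφ := hle hmem
  have hbet : ∏ s ∈ Finset.Icc 1 b, bet a b s =
      rename (Fin.natAdd a) (∏ s ∈ Finset.Icc 1 b, esymm (Fin b) ℂ s) := by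
    simp only [bet, map_prod]
  rw [Ideal.mem_comap, map_mul, hbet, hC, map_prod, mul_comm] at hφ
  simp only [halph] at hφ
  have hB := Ideal.Quotient.eq_zero_iff_mem.1 (eq_zero_of_C_mul_prod_esymm_mem _ hφ)
  refine one_ne_zero (α := ℂ) (eq_zero_of_C_mul_prod_esymm_mem (n := b) 1 ?_)
  rwa [C_1, one_mul]

end Quotient

/-- (proof of Theorem `symplectic`) For `a ≥ b ≥ 1`, the element `θ` is
congruent mod `I_a + I_b` to a nonzero multiple of the top-degree class
`(α₁ ⋯ α_a)(β₁ ⋯ β_b)`; in particular `θ ∉ I_a + I_b`. -/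
theorem stmt_6 (a b : ℕ) (hb : 1 ≤ b) (hab : b ≤ a) :
    (∃ lam : ℂ, lam ≠ 0 ∧
      theta a b - C lam * ((∏ r ∈ Finset.Icc 1 a, alph a b r) *
        (∏ s ∈ Finset.Icc 1 b, bet a b s)) ∈ Ia a b + Ib a b) ∧
      theta a b ∉ Ia a b + Ib a b := by
  have hnot := prod_alph_mul_prod_bet_notMem a b
  have hsub := theta_sub_mem a b hab
  refine ⟨⟨1, one_ne_zero, by rwa [C_1, one_mul]⟩, fun h => hnot ?_⟩
  exact (Submodule.sub_mem_iff_right _ h).1 hsub
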